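/- Let (X₀, X₁)_X and (Y₀, Y₁)_Y be pairs of compatible metric spaces with (Y, d_Y) complete, let θ ∈ (0, 1) and q ∈ [1, ∞], and let T: X → Y be a closed operator such that T(X₀) ⊆ Y₀ with T|_{X₀}: (X₀, d₀) → (Y₀, d_{Y₀}) Lipschitz with constant ω₀ > 0, and T(X₁) ⊆ Y₁ with T|_{X₁}: (X₁, d₁) → (Y₁, d_{Y₁}) Lipschitz with constant ω₁ > 0. Then for all x, y ∈ X₀ ∩ X₁, δ_{θ,q;Y}(T(x), T(y)) ≤ max{ω₀, ω₁}·δ_{θ,q;X}(x, y). -/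

import Mathlib

open scoped ENNReal Classical

/-- A function `d` is a metric on the subset `A` of `X`. -/
structure IsMetricOn {X : Type*} (d : X → X → ℝ) (A : Set X) : Prop where
  refl : ∀ x ∈ A, d x x = 0
  eq_of_dist_eq_zero : ∀ x ∈ A, ∀ y ∈ A, d x y = 0 → x = y
  symm : ∀ x ∈ A, ∀ y ∈ A, d x y = d y x
  triangle : ∀ x ∈ A, ∀ y ∈ A, ∀ z ∈ A, d x z ≤ d x y + d y z

/-- A pair of compatible metric spaces `(X₀, X₁)_X` inside an ambient metric space `X`. -/
structure CompatiblePair (X : Type*) [MetricSpace X] where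
  X0 : Set X
  X1 : Set X
  d0 : X → X → ℝ
  d1 : X → X → ℝ
  inter_nonempty : (X0 ∩ X1).Nonempty
  met0 : IsMetricOn d0 X0
  met1 : IsMetricOn d1 X1
  C0 : ℝ
  C1 : ℝ
  C0_pos : 0 < C0
  C1_pos : 0 < C1
  compat0 : ∀ x ∈ X0, ∀ y ∈ X0, dist x y ≤ C0 * d0 x y
  compat1 : ∀ x ∈ X1, ∀ y ∈ X1, dist x y ≤ C1 * d1 x y

namespace CompatiblePair

variable {X : Type*} [MetricSpace X] (P : CompatiblePair X)

/-- The `J_M` functional: `J_M(t; x, y) = max {d₀(x,y), t·d₁(x,y)}`. -/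
noncomputable def JM (t : ℝ) (x y : X) : ℝ := max (P.d0 x y) (t * P.d1 x y)

/-- The cost function `h_t` on pairs in `X₀² ∪ X₁²`. -/
noncomputable def hFun (t : ℝ) (x y : X) : ℝ :=
  if x ∈ P.X0 ∩ P.X1 ∧ y ∈ P.X0 ∩ P.X1 then min (P.d0 x y) (t * P.d1 x y)
  else if x ∈ P.X0 ∧ y ∈ P.X0 then P.d0 x y
  else t * P.d1 x y

/-- `f 0 = x, …, f n = y` is an admissible linking sequence from `x` to `y` in `X₀ ∪ X₁`. -/
def IsAdmissibleChain (x y : X) (n : ℕ) (f : ℕ → X) : Prop :=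
  f 0 = x ∧ f n = y ∧ (∀ k ≤ n, f k ∈ P.X0 ∪ P.X1) ∧
    ∀ k < n, (f k ∈ P.X0 ∧ f (k + 1) ∈ P.X0) ∨ (f k ∈ P.X1 ∧ f (k + 1) ∈ P.X1)

/-- The `K_M` functional: infimum of `∑ h_t` over admissible linking sequences. -/
noncomputable def KM (t : ℝ) (x y : X) : ℝ :=
  sInf { s : ℝ | ∃ n f, P.IsAdmissibleChain x y n f ∧
    s = ∑ k ∈ Finset.range n, P.hFun t (f k) (f (k + 1)) }

end CompatiblePair

/-- The functional `Γ_{θ,q}` of a bi-infinite real sequence, valued in `[0,∞]`. -/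
noncomputable def GammaE (θ : ℝ) (q : ℝ≥0∞) (x : ℤ → ℝ) : ℝ≥0∞ :=
  if q = ∞ then ⨆ k : ℤ, ENNReal.ofReal ((2 : ℝ) ^ (-(k : ℝ) * θ) * |x k|)
  else (∑' k : ℤ, ENNReal.ofReal ((2 : ℝ) ^ (-(k : ℝ) * θ) * |x k|) ^ q.toReal) ^ (1 / q.toReal)

/-- The real-valued functional `Γ_{θ,q}`. -/
noncomputable def Gamma (θ : ℝ) (q : ℝ≥0∞) (x : ℤ → ℝ) : ℝ := (GammaE θ q x).toReal

/-- The constant `M_{θ,q} = Γ_{θ,q}((min{1, 2^k})_k)`. -/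
noncomputable def MThetaQ (θ : ℝ) (q : ℝ≥0∞) : ℝ :=
  Gamma θ q (fun k : ℤ => min 1 ((2 : ℝ) ^ k))

/-- The constant `M'_{θ,q} = (∑_j (2^{jθ} min{1,2^{-j}})^p)^{1/p}` (with `p` the
conjugate exponent of `q`, and the supremum modification for `p = ∞`). -/
noncomputable def MConst' (θ : ℝ) (p : ℝ≥0∞) : ℝ :=
  (if p = ∞ then ⨆ j : ℤ, ENNReal.ofReal ((2 : ℝ) ^ ((j : ℝ) * θ) * min 1 ((2 : ℝ) ^ (-(j : ℝ))))
   else (∑' j : ℤ,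
      ENNReal.ofReal ((2 : ℝ) ^ ((j : ℝ) * θ) * min 1 ((2 : ℝ) ^ (-(j : ℝ)))) ^ p.toReal) ^
        (1 / p.toReal)).toReal

/-- The `ℓ^q` norm of a bi-infinite real sequence, valued in `[0,∞]`. -/
noncomputable def lqNorm (q : ℝ≥0∞) (c : ℤ → ℝ) : ℝ≥0∞ :=
  if q = ∞ then ⨆ k : ℤ, ENNReal.ofReal |c k|
  else (∑' k : ℤ, ENNReal.ofReal |c k| ^ q.toReal) ^ (1 / q.toReal)

namespace CompatiblePair

variable {X : Type*} [MetricSpace X] (P : CompatiblePair X)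

/-- The metric `β_{θ,q}(x,y) = Γ_{θ,q}((K_M(2^k; x, y))_k)` on `X₀ ∩ X₁`. -/
noncomputable def beta (θ : ℝ) (q : ℝ≥0∞) (x y : X) : ℝ :=
  Gamma θ q (fun k : ℤ => P.KM ((2 : ℝ) ^ k) x y)

/-- `u` is an approximating sequence of `x` in `(X₀ ∩ X₁, J_M(1))`: a sequence in
`X₀ ∩ X₁`, Cauchy for `J_M(1)`, with `K_M(1; uₙ, x) → 0`. -/
def IsApproxSeq (x : X) (u : ℕ → X) : Prop :=
  (∀ n, u n ∈ P.X0 ∩ P.X1) ∧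
  (∀ ε > 0, ∃ N, ∀ m ≥ N, ∀ n ≥ N, P.JM 1 (u m) (u n) < ε) ∧
  Filter.Tendsto (fun n => P.KM 1 (u n) x) Filter.atTop (nhds 0)

/-- The bi-infinite linking sequence `S_k = u_k` for `k ≥ 0`, `S_k = v_{-k}` for `k < 0`. -/
noncomputable def linkSeq (u v : ℕ → X) : ℤ → X :=
  fun k => if 0 ≤ k then u k.toNat else v (-k).toNat

/-- The functional `p_{θ,q}` valued in `[0,∞]`: infimum of
`Γ_{θ,q}((J_M(2^k; S_k, S_{k+1}))_k)` over approximating sequences of `x` and `y`. -/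
noncomputable def pFunE (θ : ℝ) (q : ℝ≥0∞) (x y : X) : ℝ≥0∞ :=
  ⨅ (u : ℕ → X) (v : ℕ → X) (_ : P.IsApproxSeq x u) (_ : P.IsApproxSeq y v),
    GammaE θ q (fun k : ℤ =>
      P.JM ((2 : ℝ) ^ k) (linkSeq u v k) (linkSeq u v (k + 1)))

/-- The real-valued functional `p_{θ,q}`. -/
noncomputable def pFun (θ : ℝ) (q : ℝ≥0∞) (x y : X) : ℝ := (P.pFunE θ q x y).toReal

/-- The symmetrization `P_{θ,q}(x,y) = (p_{θ,q}(x,y) + p_{θ,q}(y,x))/2`. -/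
noncomputable def PFun (θ : ℝ) (q : ℝ≥0∞) (x y : X) : ℝ :=
  (P.pFun θ q x y + P.pFun θ q y x) / 2

/-- The metric `δ_{θ,q}`: infimum of `∑ P_{θ,q}` over finite chains in `X₀ ∩ X₁`. -/
noncomputable def delta (θ : ℝ) (q : ℝ≥0∞) (x y : X) : ℝ :=
  sInf { s : ℝ | ∃ (n : ℕ) (f : ℕ → X), f 0 = x ∧ f n = y ∧
    (∀ k ≤ n, f k ∈ P.X0 ∩ P.X1) ∧
    s = ∑ j ∈ Finset.range n, P.PFun θ q (f j) (f (j + 1)) }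

end CompatiblePair

namespace IsMetricOn

theorem nonneg {X : Type*} {d : X → X → ℝ} {A : Set X} (h : IsMetricOn d A) {x y : X}
    (hx : x ∈ A) (hy : y ∈ A) : 0 ≤ d x y := by
  have h1 := h.triangle x hx y hy x hx
  rw [h.refl x hx, h.symm y hy x hx] at h1
  linarith

end IsMetricOn

/-- `Γ_{θ,q}` is monotone and homogeneous. -/
theorem GammaE_le_ofReal_mul {θ : ℝ} {q : ℝ≥0∞} (hq : 1 ≤ q) {M : ℝ} (hM : 0 ≤ M)
    {a b : ℤ → ℝ} (hab : ∀ k, |a k| ≤ M * |b k|) :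
    GammaE θ q a ≤ ENNReal.ofReal M * GammaE θ q b := by
  have key : ∀ k : ℤ, ENNReal.ofReal ((2 : ℝ) ^ (-(k : ℝ) * θ) * |a k|) ≤
      ENNReal.ofReal M * ENNReal.ofReal ((2 : ℝ) ^ (-(k : ℝ) * θ) * |b k|) := by
    intro k
    rw [← ENNReal.ofReal_mul hM]
    apply ENNReal.ofReal_le_ofReal
    calc (2 : ℝ) ^ (-(k : ℝ) * θ) * |a k| ≤ (2 : ℝ) ^ (-(k : ℝ) * θ) * (M * |b k|) := by
          gcongr
          exact hab k
      _ = M * ((2 : ℝ) ^ (-(k : ℝ) * θ) * |b k|) := by ring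
  unfold GammaE
  split_ifs with hq_top
  · rw [ENNReal.mul_iSup]
    exact iSup_mono key
  · have hq_pos : 0 < q.toReal := ENNReal.toReal_pos (zero_lt_one.trans_le hq).ne' hq_top
    have hM_root : ENNReal.ofReal M = (ENNReal.ofReal M ^ q.toReal) ^ (1 / q.toReal) := by
      rw [← ENNReal.rpow_mul, mul_one_div_cancel hq_pos.ne', ENNReal.rpow_one]
    rw [hM_root, ← ENNReal.mul_rpow_of_nonneg _ _ (by positivity), ← ENNReal.tsum_mul_left]
    refine ENNReal.rpow_le_rpow (ENNReal.tsum_le_tsum fun k => ?_) (by positivity)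
    rw [← ENNReal.mul_rpow_of_nonneg _ _ hq_pos.le]
    exact ENNReal.rpow_le_rpow (key k) hq_pos.le

/-- `Γ_{θ,q}` is finite on sequences with a single nonzero term. -/
theorem GammaE_ne_top_of_single {θ : ℝ} {q : ℝ≥0∞} (hq : 1 ≤ q) {a : ℤ → ℝ} (k₀ : ℤ)
    (ha : ∀ k, k ≠ k₀ → a k = 0) : GammaE θ q a ≠ ∞ := by
  unfold GammaE
  split_ifs with hq_top
  · refine ne_top_of_le_ne_top
      (ENNReal.ofReal_ne_top (r := (2 : ℝ) ^ (-(k₀ : ℝ) * θ) * |a k₀|)) (iSup_le fun k => ?_)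
    by_cases hk : k = k₀
    · rw [hk]
    · simp [ha k hk]
  · have hq_pos : 0 < q.toReal := ENNReal.toReal_pos (zero_lt_one.trans_le hq).ne' hq_top
    refine ENNReal.rpow_ne_top_of_nonneg (by positivity) ?_
    rw [tsum_eq_single k₀ fun k hk => by simp [ha k hk, hq_pos]]
    exact ENNReal.rpow_ne_top_of_nonneg hq_pos.le ENNReal.ofReal_ne_top

namespace CompatiblePair

theorem linkSeq_mem {X : Type*} {u v : ℕ → X} {A : Set X} (hu : ∀ n, u n ∈ A) (hv : ∀ n, v n ∈ A) (k : ℤ) :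
    linkSeq u v k ∈ A := by
  unfold linkSeq
  split_ifs
  exacts [hu _, hv _]

theorem linkSeq_comp {X Y : Type*} (T : X → Y) (u v : ℕ → X) (k : ℤ) :
    linkSeq (T ∘ u) (T ∘ v) k = T (linkSeq u v k) := by
  unfold linkSeq
  split_ifs <;> rfl

section Basic

variable {X : Type*} [MetricSpace X] (P : CompatiblePair X)

theorem JM_nonneg {t : ℝ} {x y : X} (hx : x ∈ P.X0) (hy : y ∈ P.X0) : 0 ≤ P.JM t x y :=
  (P.met0.nonneg hx hy).trans (le_max_left _ _)

theorem JM_self {t : ℝ} {x : X} (hx : x ∈ P.X0 ∩ P.X1) : P.JM t x x = 0 := by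
  simp [JM, P.met0.refl x hx.1, P.met1.refl x hx.2]

theorem hFun_nonneg {t : ℝ} (ht : 0 ≤ t) {x y : X}
    (h : (x ∈ P.X0 ∧ y ∈ P.X0) ∨ (x ∈ P.X1 ∧ y ∈ P.X1)) : 0 ≤ P.hFun t x y := by
  unfold hFun
  split_ifs with h1 h2
  · exact le_min (P.met0.nonneg h1.1.1 h1.2.1) (mul_nonneg ht (P.met1.nonneg h1.1.2 h1.2.2))
  · exact P.met0.nonneg h2.1 h2.2
  · obtain h | h := h
    · exact absurd h h2
    · exact mul_nonneg ht (P.met1.nonneg h.1 h.2)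

theorem sum_hFun_nonneg {t : ℝ} (ht : 0 ≤ t) {x y : X} {n : ℕ} {f : ℕ → X}
    (hf : P.IsAdmissibleChain x y n f) :
    0 ≤ ∑ k ∈ Finset.range n, P.hFun t (f k) (f (k + 1)) :=
  Finset.sum_nonneg fun k hk => P.hFun_nonneg ht (hf.2.2.2 k (Finset.mem_range.1 hk))

theorem KM_nonneg {t : ℝ} (ht : 0 ≤ t) (x y : X) : 0 ≤ P.KM t x y :=
  Real.sInf_nonneg fun _ ⟨_, _, hf, hs⟩ => hs ▸ P.sum_hFun_nonneg ht hf

theorem KM_le_sum {t : ℝ} (ht : 0 ≤ t) {x y : X} {n : ℕ} {f : ℕ → X}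
    (hf : P.IsAdmissibleChain x y n f) :
    P.KM t x y ≤ ∑ k ∈ Finset.range n, P.hFun t (f k) (f (k + 1)) :=
  csInf_le ⟨0, fun _ ⟨_, _, hg, hs⟩ => hs ▸ P.sum_hFun_nonneg ht hg⟩ ⟨n, f, hf, rfl⟩

theorem exists_isAdmissibleChain {x y : X} (hx : x ∈ P.X0) (hy : y ∈ P.X0) :
    ∃ n f, P.IsAdmissibleChain x y n f := by
  have hmem : ∀ k : ℕ, (if k = 0 then x else y) ∈ P.X0 := fun k => by split_ifs <;> assumption
  exact ⟨1, fun k => if k = 0 then x else y, by simp, by simp, fun k _ => Or.inl (hmem k),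
    fun k _ => Or.inl ⟨hmem k, hmem (k + 1)⟩⟩

theorem KM_self {t : ℝ} (ht : 0 ≤ t) {x : X} (hx : x ∈ P.X0) : P.KM t x x = 0 := by
  refine le_antisymm ?_ (P.KM_nonneg ht x x)
  have hchain : P.IsAdmissibleChain x x 0 fun _ => x :=
    ⟨rfl, rfl, fun _ _ => Or.inl hx, fun _ _ => Or.inl ⟨hx, hx⟩⟩
  simpa using P.KM_le_sum ht hchain

theorem isApproxSeq_const {x : X} (hx : x ∈ P.X0 ∩ P.X1) : P.IsApproxSeq x fun _ => x := by
  refine ⟨fun _ => hx, fun ε hε => ⟨0, fun _ _ _ _ => ?_⟩, ?_⟩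
  · rwa [P.JM_self hx]
  · simp [P.KM_self zero_le_one hx.1]

/-- `p_{θ,q}` is finite on `X₀ ∩ X₁`, as the constant approximating sequences show. -/
theorem pFunE_ne_top {θ : ℝ} {q : ℝ≥0∞} (hq : 1 ≤ q) {x y : X} (hx : x ∈ P.X0 ∩ P.X1)
    (hy : y ∈ P.X0 ∩ P.X1) : P.pFunE θ q x y ≠ ∞ := by
  refine ne_top_of_le_ne_top ?_ (iInf₂_le_of_le (fun _ => x) (fun _ => y)
    (iInf₂_le (P.isApproxSeq_const hx) (P.isApproxSeq_const hy)))
  refine GammaE_ne_top_of_single hq (-1) fun k hk => ?_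
  obtain hk | hk : 0 ≤ k ∨ k + 1 < 0 := by lia
  · have hk' : 0 ≤ k + 1 := by lia
    simpa [linkSeq, hk, hk'] using P.JM_self hx
  · have hk' : k < 0 := by lia
    simpa [linkSeq, hk.not_ge, hk'.not_ge] using P.JM_self hy

theorem PFun_nonneg (θ : ℝ) (q : ℝ≥0∞) (x y : X) : 0 ≤ P.PFun θ q x y :=
  div_nonneg (add_nonneg ENNReal.toReal_nonneg ENNReal.toReal_nonneg) zero_le_two

theorem delta_le_sum (θ : ℝ) (q : ℝ≥0∞) {x y : X} {n : ℕ} {f : ℕ → X} (h0 : f 0 = x)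
    (hn : f n = y) (hf : ∀ k ≤ n, f k ∈ P.X0 ∩ P.X1) :
    P.delta θ q x y ≤ ∑ j ∈ Finset.range n, P.PFun θ q (f j) (f (j + 1)) := by
  refine csInf_le ⟨0, ?_⟩ ⟨n, f, h0, hn, hf, rfl⟩
  rintro _ ⟨m, g, -, -, -, rfl⟩
  exact Finset.sum_nonneg fun _ _ => P.PFun_nonneg θ q _ _

end Basic

/-- `T` maps `X₀` to `Y₀` and `X₁` to `Y₁`, in both cases with Lipschitz constant `M`. -/
structure IsLipschitzMorphism {X Y : Type*} [MetricSpace X] [MetricSpace Y]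
    (PX : CompatiblePair X) (PY : CompatiblePair Y) (T : X → Y) (M : ℝ) : Prop where
  map0 : ∀ x ∈ PX.X0, T x ∈ PY.X0
  map1 : ∀ x ∈ PX.X1, T x ∈ PY.X1
  lip0 : ∀ x ∈ PX.X0, ∀ y ∈ PX.X0, PY.d0 (T x) (T y) ≤ M * PX.d0 x y
  lip1 : ∀ x ∈ PX.X1, ∀ y ∈ PX.X1, PY.d1 (T x) (T y) ≤ M * PX.d1 x y

namespace IsLipschitzMorphism

variable {X Y : Type*} [MetricSpace X] [MetricSpace Y] {PX : CompatiblePair X}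
  {PY : CompatiblePair Y} {T : X → Y} {M : ℝ}

theorem map_inter (hT : IsLipschitzMorphism PX PY T M) {x : X} (hx : x ∈ PX.X0 ∩ PX.X1) :
    T x ∈ PY.X0 ∩ PY.X1 :=
  ⟨hT.map0 x hx.1, hT.map1 x hx.2⟩

theorem mul_d1_le (hT : IsLipschitzMorphism PX PY T M) {t : ℝ} (ht : 0 ≤ t) {x y : X}
    (hx : x ∈ PX.X1) (hy : y ∈ PX.X1) : t * PY.d1 (T x) (T y) ≤ M * (t * PX.d1 x y) :=
  (mul_le_mul_of_nonneg_left (hT.lip1 x hx y hy) ht).trans_eq (mul_left_comm _ _ _)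

theorem JM_le (hT : IsLipschitzMorphism PX PY T M) (hM : 0 ≤ M) {t : ℝ} (ht : 0 ≤ t) {x y : X}
    (hx : x ∈ PX.X0 ∩ PX.X1) (hy : y ∈ PX.X0 ∩ PX.X1) :
    PY.JM t (T x) (T y) ≤ M * PX.JM t x y := by
  unfold JM
  rw [mul_max_of_nonneg _ _ hM]
  exact max_le_max (hT.lip0 x hx.1 y hy.1) (hT.mul_d1_le ht hx.2 hy.2)

theorem hFun_le (hT : IsLipschitzMorphism PX PY T M) (hM : 0 ≤ M) {t : ℝ} (ht : 0 ≤ t) {x y : X}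
    (h : (x ∈ PX.X0 ∧ y ∈ PX.X0) ∨ (x ∈ PX.X1 ∧ y ∈ PX.X1)) :
    PY.hFun t (T x) (T y) ≤ M * PX.hFun t x y := by
  have le_d0 : T x ∈ PY.X0 ∧ T y ∈ PY.X0 → PY.hFun t (T x) (T y) ≤ PY.d0 (T x) (T y) := by
    intro h0
    unfold hFun
    split_ifs
    exacts [min_le_left _ _, le_rfl]
  have le_d1 : T x ∈ PY.X1 ∧ T y ∈ PY.X1 → PY.hFun t (T x) (T y) ≤ t * PY.d1 (T x) (T y) := by
    intro h1
    unfold hFun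
    split_ifs with hi h0
    exacts [min_le_right _ _, absurd ⟨⟨h0.1, h1.1⟩, ⟨h0.2, h1.2⟩⟩ hi, le_rfl]
  have bound0 : x ∈ PX.X0 ∧ y ∈ PX.X0 → PY.hFun t (T x) (T y) ≤ M * PX.d0 x y := fun h0 =>
    (le_d0 ⟨hT.map0 x h0.1, hT.map0 y h0.2⟩).trans (hT.lip0 x h0.1 y h0.2)
  have bound1 : x ∈ PX.X1 ∧ y ∈ PX.X1 → PY.hFun t (T x) (T y) ≤ M * (t * PX.d1 x y) := fun h1 =>
    (le_d1 ⟨hT.map1 x h1.1, hT.map1 y h1.2⟩).trans (hT.mul_d1_le ht h1.1 h1.2)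
  rw [hFun.eq_1 PX]
  split_ifs with hi h0
  · rw [mul_min_of_nonneg _ _ hM]
    exact le_min (bound0 ⟨hi.1.1, hi.2.1⟩) (bound1 ⟨hi.1.2, hi.2.2⟩)
  · exact bound0 h0
  · exact bound1 (h.resolve_left h0)

theorem isAdmissibleChain (hT : IsLipschitzMorphism PX PY T M) {x y : X} {n : ℕ} {f : ℕ → X}
    (hf : PX.IsAdmissibleChain x y n f) : PY.IsAdmissibleChain (T x) (T y) n (T ∘ f) :=
  ⟨congrArg T hf.1, congrArg T hf.2.1,
    fun k hk => (hf.2.2.1 k hk).imp (hT.map0 _) (hT.map1 _),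
    fun k hk => (hf.2.2.2 k hk).imp (And.imp (hT.map0 _) (hT.map0 _))
      (And.imp (hT.map1 _) (hT.map1 _))⟩

theorem KM_le (hT : IsLipschitzMorphism PX PY T M) (hM : 0 < M) {t : ℝ} (ht : 0 ≤ t) {x y : X}
    (hx : x ∈ PX.X0) (hy : y ∈ PX.X0) : PY.KM t (T x) (T y) ≤ M * PX.KM t x y := by
  rw [← div_le_iff₀' hM]
  obtain ⟨n, f, hf⟩ := PX.exists_isAdmissibleChain hx hy
  refine le_csInf ⟨_, n, f, hf, rfl⟩ ?_
  rintro _ ⟨m, g, hg, rfl⟩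
  rw [div_le_iff₀' hM, Finset.mul_sum]
  exact (PY.KM_le_sum ht (hT.isAdmissibleChain hg)).trans (Finset.sum_le_sum fun k hk =>
    hT.hFun_le hM.le ht (hg.2.2.2 k (Finset.mem_range.1 hk)))

theorem isApproxSeq (hT : IsLipschitzMorphism PX PY T M) (hM : 0 < M) {x : X} (hx : x ∈ PX.X0)
    {u : ℕ → X} (hu : PX.IsApproxSeq x u) : PY.IsApproxSeq (T x) (T ∘ u) := by
  obtain ⟨hmem, hcauchy, hlim⟩ := hu
  refine ⟨fun n => hT.map_inter (hmem n), fun ε hε => ?_, ?_⟩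
  · obtain ⟨N, hN⟩ := hcauchy (ε / M) (div_pos hε hM)
    refine ⟨N, fun m hm n hn => ?_⟩
    exact (hT.JM_le hM.le zero_le_one (hmem m) (hmem n)).trans_lt
      ((lt_div_iff₀' hM).1 (hN m hm n hn))
  · refine squeeze_zero (fun n => PY.KM_nonneg zero_le_one _ _)
      (fun n => hT.KM_le hM zero_le_one (hmem n).1 hx) ?_
    simpa using hlim.const_mul M

theorem pFunE_le (hT : IsLipschitzMorphism PX PY T M) (hM : 0 < M) {θ : ℝ} {q : ℝ≥0∞}
    (hq : 1 ≤ q) {x y : X} (hx : x ∈ PX.X0) (hy : y ∈ PX.X0) :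
    PY.pFunE θ q (T x) (T y) ≤ ENNReal.ofReal M * PX.pFunE θ q x y := by
  have hM0 : ENNReal.ofReal M ≠ 0 := (ENNReal.ofReal_pos.2 hM).ne'
  rw [← ENNReal.div_le_iff' hM0 ENNReal.ofReal_ne_top]
  refine le_iInf₂ fun u v => le_iInf₂ fun hu hv => ?_
  rw [ENNReal.div_le_iff' hM0 ENNReal.ofReal_ne_top]
  refine (iInf₂_le_of_le (T ∘ u) (T ∘ v)
    (iInf₂_le (hT.isApproxSeq hM hx hu) (hT.isApproxSeq hM hy hv))).trans
    (GammaE_le_ofReal_mul hq hM.le fun k => ?_)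
  have hS := linkSeq_mem hu.1 hv.1
  rw [linkSeq_comp, linkSeq_comp, abs_of_nonneg (PX.JM_nonneg (hS k).1 (hS (k + 1)).1),
    abs_of_nonneg (PY.JM_nonneg (hT.map0 _ (hS k).1) (hT.map0 _ (hS (k + 1)).1))]
  exact hT.JM_le hM.le (by positivity) (hS k) (hS (k + 1))

theorem pFun_le (hT : IsLipschitzMorphism PX PY T M) (hM : 0 < M) {θ : ℝ} {q : ℝ≥0∞}
    (hq : 1 ≤ q) {x y : X} (hx : x ∈ PX.X0 ∩ PX.X1) (hy : y ∈ PX.X0 ∩ PX.X1) :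
    PY.pFun θ q (T x) (T y) ≤ M * PX.pFun θ q x y := by
  have h := ENNReal.toReal_mono (ENNReal.mul_ne_top ENNReal.ofReal_ne_top
    (PX.pFunE_ne_top hq hx hy)) (hT.pFunE_le (θ := θ) hM hq hx.1 hy.1)
  rwa [ENNReal.toReal_mul, ENNReal.toReal_ofReal hM.le] at h

theorem PFun_le (hT : IsLipschitzMorphism PX PY T M) (hM : 0 < M) {θ : ℝ} {q : ℝ≥0∞}
    (hq : 1 ≤ q) {x y : X} (hx : x ∈ PX.X0 ∩ PX.X1) (hy : y ∈ PX.X0 ∩ PX.X1) :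
    PY.PFun θ q (T x) (T y) ≤ M * PX.PFun θ q x y := by
  have h1 := hT.pFun_le (θ := θ) hM hq hx hy
  have h2 := hT.pFun_le (θ := θ) hM hq hy hx
  unfold PFun
  linarith

theorem delta_le (hT : IsLipschitzMorphism PX PY T M) (hM : 0 < M) {θ : ℝ} {q : ℝ≥0∞}
    (hq : 1 ≤ q) {x y : X} (hx : x ∈ PX.X0 ∩ PX.X1) (hy : y ∈ PX.X0 ∩ PX.X1) :
    PY.delta θ q (T x) (T y) ≤ M * PX.delta θ q x y := by
  rw [← div_le_iff₀' hM]
  refine le_csInf ⟨_, 1, fun k => if k = 0 then x else y, by simp, by simp,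
    fun k _ => by dsimp only; split_ifs <;> assumption, rfl⟩ ?_
  rintro _ ⟨n, f, h0, hn, hf, rfl⟩
  rw [div_le_iff₀' hM, Finset.mul_sum]
  refine (PY.delta_le_sum θ q (f := T ∘ f) (congrArg T h0) (congrArg T hn)
    fun k hk => hT.map_inter (hf k hk)).trans (Finset.sum_le_sum fun j hj => ?_)
  have hj := Finset.mem_range.1 hj
  exact hT.PFun_le hM hq (hf j hj.le) (hf (j + 1) hj)

end IsLipschitzMorphism

end CompatiblePair

/-- `δ_{θ,q;Y}(T x, T y) ≤ max{ω₀, ω₁} · δ_{θ,q;X}(x, y)` on `X₀ ∩ X₁`. -/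
theorem delta_lipschitz_interpolation_max {X Y : Type*} [MetricSpace X] [MetricSpace Y]
    [CompleteSpace Y]
    (PX : CompatiblePair X) (PY : CompatiblePair Y)
    (θ : ℝ) (hθ : θ ∈ Set.Ioo (0 : ℝ) 1) (q : ℝ≥0∞) (hq : 1 ≤ q)
    (T : X → Y)
    (hclosed : ∀ (u : ℕ → X) (x : X) (y : Y),
      Filter.Tendsto u Filter.atTop (nhds x) →
      Filter.Tendsto (fun n => T (u n)) Filter.atTop (nhds y) → y = T x)
    (ω₀ ω₁ : ℝ) (hω₀ : 0 < ω₀) (hω₁ : 0 < ω₁)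
    (hT0 : ∀ x ∈ PX.X0, T x ∈ PY.X0)
    (hLip0 : ∀ x ∈ PX.X0, ∀ y ∈ PX.X0, PY.d0 (T x) (T y) ≤ ω₀ * PX.d0 x y)
    (hT1 : ∀ x ∈ PX.X1, T x ∈ PY.X1)
    (hLip1 : ∀ x ∈ PX.X1, ∀ y ∈ PX.X1, PY.d1 (T x) (T y) ≤ ω₁ * PX.d1 x y) :
    ∀ x ∈ PX.X0 ∩ PX.X1, ∀ y ∈ PX.X0 ∩ PX.X1,
      PY.delta θ q (T x) (T y) ≤ max ω₀ ω₁ * PX.delta θ q x y := by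
  have hT : CompatiblePair.IsLipschitzMorphism PX PY T (max ω₀ ω₁) :=
    { map0 := hT0
      map1 := hT1
      lip0 := fun x hx y hy => (hLip0 x hx y hy).trans
        (mul_le_mul_of_nonneg_right (le_max_left _ _) (PX.met0.nonneg hx hy))
      lip1 := fun x hx y hy => (hLip1 x hx y hy).trans
        (mul_le_mul_of_nonneg_right (le_max_right _ _) (PX.met1.nonneg hx hy)) }
  exact fun x hx y hy => hT.delta_le (lt_max_of_lt_left hω₀) hq hx hy
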